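/- arXiv:2410.04544 — 2 statements merged into one kernel-verified Lean document; each statement's English description precedes it below -/
import Mathlib

section
/- Let u and v be adjacent vertices on the convex hull of a finite planar point set P in general position. Then |A(u) ∩ A(v)| ≤ 1, where A(w) denotes the set of points active for w (points that are vertices of CH(P \ {w}) but not of CH(P)). -/
open Set MeasureTheory

noncomputable section

abbrev Pt := EuclideanSpace ℝ (Fin 2)

/-- General position: no three distinct points of `S` are collinear. -/
def GenPos (S : Set Pt) : Prop :=
  ∀ p q r : Pt, p ∈ S → q ∈ S → r ∈ S → p ≠ q → q ≠ r → p ≠ r →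
    ¬ Collinear ℝ ({p, q, r} : Set Pt)

/-- `p` is a vertex (extreme point) of the convex hull of `S`. -/
def IsHullVertex (S : Set Pt) (p : Pt) : Prop :=
  p ∈ S ∧ p ∉ convexHull ℝ (S \ {p})

/-- `p` is active for the hull vertex `u` of `S`: it is a vertex of
`CH(S \ {u})` but not a vertex of `CH(S)`. -/
def ActiveFor (S : Set Pt) (u p : Pt) : Prop :=
  IsHullVertex (S \ {u}) p ∧ ¬ IsHullVertex S p

/-- `a` and `b` are adjacent (consecutive) vertices on the convex hull of `S`:
both are hull vertices and the segment between them lies on the hull boundary. -/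
def AdjacentVertices (S : Set Pt) (a b : Pt) : Prop :=
  a ≠ b ∧ IsHullVertex S a ∧ IsHullVertex S b ∧
    segment ℝ a b ⊆ frontier (convexHull ℝ S)

/-- 2D cross product. -/
def cross2 (a b : Pt) : ℝ := a 0 * b 1 - a 1 * b 0

/-- `(t, u, v)` are consecutive vertices of the hull of `S`, in clockwise order
(the turn `t → u → v` is a right turn). -/
def ConsecutiveCW (S : Set Pt) (t u v : Pt) : Prop :=
  AdjacentVertices S t u ∧ AdjacentVertices S u v ∧ t ≠ v ∧
    cross2 (u - t) (v - u) ≤ 0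

/-- Area of the convex hull of `S`. -/
def hullArea (S : Set Pt) : ENNReal := volume (convexHull ℝ S)

/-- Orientation of a triple. -/
def ori (a b c : Pt) : ℝ := (b 0 - a 0) * (c 1 - a 1) - (b 1 - a 1) * (c 0 - a 0)

theorem ori_rot (a b c : Pt) : ori b c a = ori a b c := by unfold ori; ring

theorem ori_swap (a b c : Pt) : ori b a c = - ori a b c := by unfold ori; ring

theorem ori_half (S : Set Pt) (a b z : Pt) (h : ∀ x ∈ S, 0 ≤ ori a b x)
    (hz : z ∈ convexHull ℝ S) : 0 ≤ ori a b z := by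
  have hc : Convex ℝ {x : Pt | 0 ≤ ori a b x} := by
    intro x hx y hy s t hs ht hst
    simp only [Set.mem_setOf_eq] at *
    have : ori a b (s • x + t • y) = s * ori a b x + t * ori a b y := by
      obtain rfl : t = 1 - s := by linarith
      simp [ori]; ring
    rw [this]; positivity
  exact convexHull_min h hc hz

theorem mem_tri (S : Set Pt) (a b c z : Pt) (ha : a ∈ S) (hb : b ∈ S) (hc : c ∈ S)
    (h1 : 0 ≤ ori a b z) (h2 : 0 ≤ ori b c z) (h3 : 0 ≤ ori c a z)
    (h : 0 < ori a b z + ori b c z + ori c a z) : z ∈ convexHull ℝ S := by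
  set D := ori a b z + ori b c z + ori c a z with hD
  have hz : z = ∑ i : Fin 3, (![ori b c z / D, ori c a z / D, ori a b z / D] i) • (![a, b, c] i) := by
    have hne : D ≠ 0 := h.ne'
    ext i
    simp only [Fin.sum_univ_three, Matrix.cons_val_zero, Matrix.cons_val_one, Matrix.cons_val,
      PiLp.add_apply, PiLp.smul_apply, smul_eq_mul]
    field_simp
    rw [hD]
    fin_cases i <;> simp [ori] <;> ring
  rw [hz]
  refine (convex_convexHull ℝ S).sum_mem ?_ ?_ ?_
  · intro i _
    fin_cases i <;> simp <;> positivity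
  · simp only [Fin.sum_univ_three, Matrix.cons_val_zero, Matrix.cons_val_one, Matrix.cons_val]
    have hne : D ≠ 0 := h.ne'
    field_simp
    rw [hD]; ring
  · intro i _
    fin_cases i <;> simp <;> apply subset_convexHull <;> assumption

theorem collinear_of_ori (a b c : Pt) (hab : a ≠ b) (h : ori a b c = 0) :
    Collinear ℝ ({a, b, c} : Set Pt) := by
  rw [collinear_iff_of_mem (p₀ := a) (by simp)]
  refine ⟨b - a, ?_⟩
  have hn : 0 < (b 0 - a 0) ^ 2 + (b 1 - a 1) ^ 2 := by
    by_contra hcon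
    apply hab
    have h0 : b 0 - a 0 = 0 := by nlinarith [sq_nonneg (b 0 - a 0), sq_nonneg (b 1 - a 1)]
    have h1 : b 1 - a 1 = 0 := by nlinarith [sq_nonneg (b 0 - a 0), sq_nonneg (b 1 - a 1)]
    ext i
    fin_cases i <;> simp <;> linarith
  intro p hp
  simp only [Set.mem_insert_iff, Set.mem_singleton_iff] at hp
  rcases hp with rfl | rfl | rfl
  · exact ⟨0, by simp⟩
  · exact ⟨1, by simp⟩
  · refine ⟨((b 0 - a 0) * (p 0 - a 0) + (b 1 - a 1) * (p 1 - a 1)) /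
      ((b 0 - a 0) ^ 2 + (b 1 - a 1) ^ 2), ?_⟩
    have hne := hn.ne'
    unfold ori at h
    ext i
    fin_cases i
    · simp
      field_simp
      linear_combination (-(b 1 - a 1)) * h
    · simp
      field_simp
      linear_combination (b 0 - a 0) * h

theorem ori_ne (S : Set Pt) (hgp : GenPos S) (a b c : Pt) (ha : a ∈ S) (hb : b ∈ S) (hc : c ∈ S)
    (hab : a ≠ b) (hbc : b ≠ c) (hac : a ≠ c) : ori a b c ≠ 0 :=
  fun h => hgp a b c ha hb hc hab hbc hac (collinear_of_ori a b c hab h)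

theorem exists_third (S : Set Pt) (hgp : GenPos S) (u v p : Pt) (huv : u ≠ v)
    (hu : u ∈ S) (hv : v ∈ S)
    (h1 : ActiveFor S u p) (h2 : ActiveFor S v p) :
    p ∈ S ∧ p ≠ u ∧ p ≠ v ∧ ∃ x ∈ S, x ≠ u ∧ x ≠ v ∧ x ≠ p ∧ p ∈ convexHull ℝ {u, v, x} := by
  obtain ⟨⟨⟨hpS, hpu⟩, hpu'⟩, hn⟩ := h1
  obtain ⟨⟨⟨_, hpv⟩, hpv'⟩, _⟩ := h2
  have hpu2 : p ≠ u := hpu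
  have hpv2 : p ≠ v := hpv
  have hp : p ∈ convexHull ℝ (S \ {p}) := by
    by_contra hc
    exact hn ⟨hpS, hc⟩
  rw [convexHull_eq_union] at hp
  simp only [Set.mem_iUnion] at hp
  obtain ⟨t, hts, hai, hpt⟩ := hp
  have hut : u ∈ t := by
    by_contra hc
    refine hpu' (convexHull_mono ?_ hpt)
    intro z hz
    refine ⟨⟨(hts hz).1, ?_⟩, (hts hz).2⟩
    rintro rfl
    exact hc hz
  have hvt : v ∈ t := by
    by_contra hc
    refine hpv' (convexHull_mono ?_ hpt)
    intro z hz
    refine ⟨⟨(hts hz).1, ?_⟩, (hts hz).2⟩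
    rintro rfl
    exact hc hz
  have hcard : t.card ≤ 3 := by
    have := hai.card_le_finrank_succ
    have h2 := Submodule.finrank_le (vectorSpan ℝ (Set.range ((↑) : t → Pt)))
    rw [finrank_euclideanSpace_fin] at h2
    simp only [Fintype.card_coe] at this
    omega
  refine ⟨hpS, hpu2, hpv2, ?_⟩
  by_cases hx : ∃ x ∈ t, x ≠ u ∧ x ≠ v
  · obtain ⟨x, hxt, hxu, hxv⟩ := hx
    refine ⟨x, (hts hxt).1, hxu, hxv, (hts hxt).2, ?_⟩
    have hsub : ({u, v, x} : Finset Pt) ⊆ t := by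
      intro z hz
      simp only [Finset.mem_insert, Finset.mem_singleton] at hz
      rcases hz with rfl | rfl | rfl <;> assumption
    have hc3 : ({u, v, x} : Finset Pt).card = 3 :=
      Finset.card_eq_three.2 ⟨u, v, x, huv, hxu.symm, hxv.symm, rfl⟩
    have := Finset.eq_of_subset_of_card_le hsub (by omega)
    rw [← this] at hpt
    simpa using hpt
  · exfalso
    push Not at hx
    have hz : ∀ x ∈ (t : Set Pt), ori u v x = 0 := by
      intro x hxt
      by_cases hxu : x = u
      · subst hxu; simp [ori]
      · rw [hx x hxt hxu]; unfold ori; ring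
    have ha := ori_half t u v p (fun x hx => (hz x hx).ge) hpt
    have hb := ori_half t v u p (fun x hx => by rw [ori_swap, hz x hx]; simp) hpt
    rw [ori_swap] at hb
    exact ori_ne S hgp u v p hu hv hpS huv hpv2.symm hpu2.symm (by linarith)

/-- Points of `S` cannot lie on different sides of a hull edge. -/
theorem same_side (S : Set Pt) (u v p q : Pt) (hu : u ∈ S) (hv : v ∈ S) (hp : p ∈ S) (hq : q ∈ S)
    (hf : segment ℝ u v ⊆ frontier (convexHull ℝ S))
    (h1 : 0 < ori u v p) (h2 : ori u v q < 0) : False := by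
  have hm : midpoint ℝ u v ∈ frontier (convexHull ℝ S) := hf (midpoint_mem_segment u v)
  refine hm.2 ?_
  rw [mem_interior]
  refine ⟨{z | 0 < ori v p z} ∩ {z | 0 < ori p u z} ∩ ({z | 0 < ori u q z} ∩ {z | 0 < ori q v z}),
    ?_, ?_, ?_⟩
  · rintro z ⟨⟨ha, hb⟩, hc, hd⟩
    simp only [Set.mem_setOf_eq] at ha hb hc hd
    by_cases h : 0 ≤ ori u v z
    · exact mem_tri S u v p z hu hv hp h ha.le hb.le (by linarith)
    · have : 0 < ori v u z := by rw [ori_swap]; linarith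
      exact mem_tri S v u q z hv hu hq this.le hc.le hd.le (by linarith)
  · have : ∀ a b : Pt, IsOpen {z | 0 < ori a b z} := by
      intro a b
      refine isOpen_lt continuous_const ?_
      unfold ori
      fun_prop
    exact ((this _ _).inter (this _ _)).inter ((this _ _).inter (this _ _))
  · have e0 : (midpoint ℝ u v) 0 = (u 0 + v 0) / 2 := by
      simp [midpoint_eq_smul_add]; ring
    have e1 : (midpoint ℝ u v) 1 = (u 1 + v 1) / 2 := by
      simp [midpoint_eq_smul_add]; ring
    simp only [Set.mem_inter_iff, Set.mem_setOf_eq]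
    unfold ori at *
    rw [e0, e1]
    refine ⟨⟨?_, ?_⟩, ?_, ?_⟩ <;> linarith

theorem core (S : Set Pt) (u v p q x : Pt) (hu : u ∈ S) (hv : v ∈ S) (hq : q ∈ S) (hx : x ∈ S)
    (huv : u ≠ v) (hpu : p ≠ u) (hpv : p ≠ v) (hqu : q ≠ u) (hqv : q ≠ v) (hpq : p ≠ q)
    (hxu : x ≠ u) (hxv : x ≠ v) (hxp : x ≠ p)
    (h1 : ActiveFor S u p) (h2 : ActiveFor S v p)
    (hpx : p ∈ convexHull ℝ {u, v, x}) (hp0 : 0 < ori u v p)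
    (hs : ori u p q < 0) : False := by
  have hx0 : 0 < ori u v x := by
    by_contra hc
    have := ori_half {u, v, x} v u p (by
      intro z hz
      simp only [Set.mem_insert_iff, Set.mem_singleton_iff] at hz
      rcases hz with rfl | rfl | rfl
      · unfold ori; apply le_of_eq; ring
      · simp [ori]
      · rw [ori_swap]; linarith) hpx
    rw [ori_swap] at this
    linarith
  have hvx : 0 ≤ ori v x p := ori_half {u, v, x} v x p (by
      intro z hz
      simp only [Set.mem_insert_iff, Set.mem_singleton_iff] at hz
      rcases hz with rfl | rfl | rfl
      · rw [ori_rot]; exact hx0.le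
      · simp [ori]
      · unfold ori; apply le_of_eq; ring) hpx
  have hxu' : 0 ≤ ori x u p := ori_half {u, v, x} x u p (by
      intro z hz
      simp only [Set.mem_insert_iff, Set.mem_singleton_iff] at hz
      rcases hz with rfl | rfl | rfl
      · unfold ori; apply le_of_eq; ring
      · rw [← ori_rot]; exact hx0.le
      · simp [ori]) hpx
  have huq : 0 < ori u q p := by
    have : ori u q p = - ori u p q := by unfold ori; ring
    linarith
  have pl : ori q x p * ori u v p = ori u q p * ori v x p + ori v q p * ori x u p := by
    unfold ori; ring
  by_cases hqx : 0 ≤ ori q x p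
  · exact h2.1.2 (mem_tri _ u q x p ⟨⟨hu, huv⟩, hpu.symm⟩ ⟨⟨hq, hqv⟩, hpq.symm⟩
      ⟨⟨hx, hxv⟩, hxp⟩ huq.le hqx hxu' (by linarith))
  · push Not at hqx
    have hvq : ori v q p < 0 := by
      by_contra hc
      push Not at hc
      have := mul_neg_of_neg_of_pos hqx hp0
      have := mul_nonneg huq.le hvx
      have := mul_nonneg hc hxu'
      linarith
    have hqv' : 0 < ori q v p := by rw [ori_swap]; linarith
    have hxq : 0 < ori x q p := by rw [ori_swap]; linarith
    exact h1.1.2 (mem_tri _ q v x p ⟨⟨hq, hqu⟩, hpq.symm⟩ ⟨⟨hv, huv.symm⟩, hpv.symm⟩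
      ⟨⟨hx, hxu⟩, hxp⟩ hqv'.le hvx hxq.le (by linarith))

theorem main_pos (S : Set Pt) (hgp : GenPos S) (u v p q : Pt) (huv : u ≠ v) (hu : u ∈ S)
    (hv : v ∈ S) (hf : segment ℝ u v ⊆ frontier (convexHull ℝ S)) (hpq : p ≠ q)
    (hp1 : ActiveFor S u p) (hp2 : ActiveFor S v p)
    (hq1 : ActiveFor S u q) (hq2 : ActiveFor S v q) (h0 : 0 < ori u v p) : False := by
  obtain ⟨hp, hpu, hpv, x, hx, hxu, hxv, hxp, hpx⟩ := exists_third S hgp u v p huv hu hv hp1 hp2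
  obtain ⟨hq, hqu, hqv, y, hy, hyu, hyv, hyq, hqy⟩ := exists_third S hgp u v q huv hu hv hq1 hq2
  have hq0 : 0 < ori u v q := by
    rcases lt_trichotomy (ori u v q) 0 with h | h | h
    · exact (same_side S u v p q hu hv hp hq hf h0 h).elim
    · exact (ori_ne S hgp u v q hu hv hq huv hqv.symm hqu.symm h).elim
    · exact h
  rcases lt_trichotomy (ori u p q) 0 with h | h | h
  · exact core S u v p q x hu hv hq hx huv hpu hpv hqu hqv hpq hxu hxv hxp hp1 hp2 hpx h0 h
  · exact ori_ne S hgp u p q hu hp hq hpu.symm hpq hqu.symm h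
  · refine core S u v q p y hu hv hp hy huv hqu hqv hpu hpv hpq.symm hyu hyv hyq hq1 hq2 hqy hq0 ?_
    have : ori u q p = - ori u p q := by unfold ori; ring
    linarith

theorem adjacent_active_sets_small_intersection (P : Finset Pt)
    (hgp : GenPos (↑P : Set Pt)) (u v : Pt)
    (hadj : AdjacentVertices (↑P : Set Pt) u v) :
    Set.ncard {p : Pt | ActiveFor (↑P : Set Pt) u p ∧ ActiveFor (↑P : Set Pt) v p} ≤ 1 := by
  obtain ⟨huv, ⟨hu, _⟩, ⟨hv, _⟩, hf⟩ := hadj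
  suffices key : {p : Pt | ActiveFor (↑P : Set Pt) u p ∧ ActiveFor (↑P : Set Pt) v p}.Subsingleton by
    exact (Set.ncard_le_one key.finite).2 (fun a ha b hb => key ha hb)
  rintro p ⟨hp1, hp2⟩ q ⟨hq1, hq2⟩
  by_contra hpq
  have hpS : p ∈ (P : Set Pt) := hp1.1.1.1
  have hpu : p ≠ u := hp1.1.1.2
  have hpv : p ≠ v := hp2.1.1.2
  rcases lt_trichotomy (ori u v p) 0 with h | h | h
  · refine main_pos P hgp v u p q huv.symm hv hu (by rwa [segment_symm]) hpq hp2 hp1 hq2 hq1 ?_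
    rw [ori_swap]; linarith
  · exact ori_ne P hgp u v p hu hv hpS huv hpv.symm hpu.symm h
  · exact main_pos P hgp u v p q huv hu hv hf hpq hp1 hp2 hq1 hq2 h
end
end

section
/- Let u be a vertex of the convex hull of a finite planar point set P in general position, with counterclockwise neighbor t and clockwise neighbor v, and let A(u) = (a₁, ..., a_m) be the points active for u, ordered along CH(P \ {u}) from t to v. Then the sensitivity of u satisfies area(CH(P)) − area(CH(P \ {u})) = area of the simple polygon with vertices t, u, v, a_m, ..., a₁ (in order). -/
open Set MeasureTheory

noncomputable section

/-- Area of the polygon with the given (cyclically ordered) vertex list,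
via the shoelace formula. -/
def shoelace (l : List Pt) : ℝ :=
  |((l.zip (l.rotate 1)).map (fun q => q.1 0 * q.2 1 - q.2 0 * q.1 1)).sum| / 2


/-- Twice the signed area of the triangle `a b c`. -/
def orr (a b c : Pt) : ℝ := (b 0 - a 0) * (c 1 - a 1) - (b 1 - a 1) * (c 0 - a 0)

/-- Triangle with apex `u`, by inequalities. -/
def tri (u a b : Pt) : Set Pt :=
  {x | 0 ≤ orr u a x ∧ 0 ≤ orr u x b ∧ orr u a x + orr u x b ≤ orr u a b}

lemma vol_std_prod (c : ℝ) (hc : 0 ≤ c) :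
    volume {z : ℝ × ℝ | 0 ≤ z.1 ∧ 0 ≤ z.2 ∧ z.1 + z.2 ≤ c} = ENNReal.ofReal (c ^ 2 / 2) := by
  have hm : MeasurableSet {z : ℝ × ℝ | 0 ≤ z.1 ∧ 0 ≤ z.2 ∧ z.1 + z.2 ≤ c} := by
    have h1 : IsClosed {z : ℝ × ℝ | 0 ≤ z.1} := isClosed_le (by fun_prop) (by fun_prop)
    have h2 : IsClosed {z : ℝ × ℝ | 0 ≤ z.2} := isClosed_le (by fun_prop) (by fun_prop)
    have h3 : IsClosed {z : ℝ × ℝ | z.1 + z.2 ≤ c} := isClosed_le (by fun_prop) (by fun_prop)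
    exact (h1.inter (h2.inter h3)).measurableSet
  rw [Measure.volume_eq_prod, Measure.prod_apply hm]
  have h1 : ∀ x : ℝ, volume (Prod.mk x ⁻¹' {z : ℝ × ℝ | 0 ≤ z.1 ∧ 0 ≤ z.2 ∧ z.1 + z.2 ≤ c})
      = (Icc 0 c).indicator (fun x => ENNReal.ofReal (c - x)) x := by
    intro x
    by_cases hx : x ∈ Icc 0 c
    · rw [indicator_of_mem hx]
      have : Prod.mk x ⁻¹' {z : ℝ × ℝ | 0 ≤ z.1 ∧ 0 ≤ z.2 ∧ z.1 + z.2 ≤ c} = Icc 0 (c - x) := by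
        ext y
        simp only [mem_preimage, mem_ofPred_eq, mem_Icc]
        constructor
        · rintro ⟨_, h2, h3⟩; exact ⟨h2, by linarith⟩
        · rintro ⟨h2, h3⟩; exact ⟨hx.1, h2, by linarith⟩
      rw [this, Real.volume_Icc]; simp
    · rw [indicator_of_notMem hx]
      have : Prod.mk x ⁻¹' {z : ℝ × ℝ | 0 ≤ z.1 ∧ 0 ≤ z.2 ∧ z.1 + z.2 ≤ c} = ∅ := by
        ext y
        simp only [mem_preimage, mem_ofPred_eq, mem_empty_iff_false, iff_false]
        rintro ⟨h1, h2, h3⟩; exact hx ⟨h1, by linarith⟩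
      rw [this]; simp
  simp_rw [h1]
  rw [lintegral_indicator measurableSet_Icc, ← ofReal_integral_eq_lintegral_ofReal]
  · rw [integral_Icc_eq_integral_Ioc, ← intervalIntegral.integral_of_le hc]
    congr 1
    rw [intervalIntegral.integral_sub (by simp) (by simp)]
    simp
    ring
  · exact (by fun_prop : Continuous fun x : ℝ => c - x).continuousOn.integrableOn_Icc
  · filter_upwards [ae_restrict_mem measurableSet_Icc] with x hx
    simpa using hx.2

lemma vol_std (c : ℝ) (hc : 0 ≤ c) :
    volume {z : Pt | 0 ≤ z 0 ∧ 0 ≤ z 1 ∧ z 0 + z 1 ≤ c} = ENNReal.ofReal (c ^ 2 / 2) := by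
  rw [← vol_std_prod c hc]
  have h := (volume_preserving_finTwoArrow ℝ).comp
    (EuclideanSpace.volume_preserving_symm_measurableEquiv_toLp (Fin 2))
  rw [← h.measure_preimage]
  · rfl
  apply MeasurableSet.nullMeasurableSet
  have h1 : IsClosed {z : ℝ × ℝ | 0 ≤ z.1} := isClosed_le (by fun_prop) (by fun_prop)
  have h2 : IsClosed {z : ℝ × ℝ | 0 ≤ z.2} := isClosed_le (by fun_prop) (by fun_prop)
  have h3 : IsClosed {z : ℝ × ℝ | z.1 + z.2 ≤ c} := isClosed_le (by fun_prop) (by fun_prop)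
  exact (h1.inter (h2.inter h3)).measurableSet

lemma vol_preimage_sub (u : Pt) (A : Set Pt) :
    volume ((fun x => x - u) ⁻¹' A) = volume A := by
  simp only [sub_eq_add_neg]
  exact measure_preimage_add_right volume (-u) A

lemma vol_tri (u a b : Pt) (h : 0 < orr u a b) :
    volume (tri u a b) = ENNReal.ofReal (orr u a b / 2) := by
  let M : Matrix (Fin 2) (Fin 2) ℝ := !![b 1 - u 1, -(b 0 - u 0); -(a 1 - u 1), a 0 - u 0]
  let f : Pt →ₗ[ℝ] Pt := Matrix.toLin (PiLp.basisFun 2 ℝ (Fin 2)) (PiLp.basisFun 2 ℝ (Fin 2)) M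
  have hdet : LinearMap.det f = orr u a b := by
    simp only [f, LinearMap.det_toLin, M, Matrix.det_fin_two_of, orr]; ring
  have hf : ∀ w : Pt, f w 0 = (b 1 - u 1) * w 0 - (b 0 - u 0) * w 1 ∧
      f w 1 = -(a 1 - u 1) * w 0 + (a 0 - u 0) * w 1 := by
    intro w
    simp [f, M, Matrix.toLin_apply, Matrix.mulVec, dotProduct, Fin.sum_univ_two]
    ring
  have hset : tri u a b =
      (fun x => x - u) ⁻¹' (f ⁻¹' {z : Pt | 0 ≤ z 0 ∧ 0 ≤ z 1 ∧ z 0 + z 1 ≤ orr u a b}) := by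
    ext x
    simp only [tri, mem_ofPred_eq, mem_preimage, hf]
    have e1 : orr u a x = -(a 1 - u 1) * (x - u) 0 + (a 0 - u 0) * (x - u) 1 := by
      simp [orr]; ring
    have e2 : orr u x b = (b 1 - u 1) * (x - u) 0 - (b 0 - u 0) * (x - u) 1 := by
      simp [orr]; ring
    rw [e1, e2]
    constructor
    · rintro ⟨h1, h2, h3⟩; exact ⟨h2, h1, by linarith⟩
    · rintro ⟨h1, h2, h3⟩; exact ⟨h2, h1, by linarith⟩
  rw [hset, vol_preimage_sub,
    Measure.addHaar_preimage_linearMap volume (by rw [hdet]; exact h.ne'), hdet,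
    vol_std _ h.le, ← ENNReal.ofReal_mul (by positivity), abs_of_pos (by positivity)]
  congr 1
  field_simp

lemma vol_line (p q c : ℝ) (h : p ≠ 0 ∨ q ≠ 0) :
    volume {x : Pt | p * x 0 + q * x 1 = c} = 0 := by
  by_cases hne : ∃ x0 : Pt, p * x0 0 + q * x0 1 = c
  · obtain ⟨x0, hx0⟩ := hne
    let g : Pt →ₗ[ℝ] ℝ := 
      { toFun := fun x => p * x 0 + q * x 1
        map_add' := by intro x y; simp; ring
        map_smul' := by intro r x; simp; ring }
    have hs : {x : Pt | p * x 0 + q * x 1 = c} = (fun x => x - x0) ⁻¹' (LinearMap.ker g : Set Pt) := by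
      ext x
      simp only [mem_ofPred_eq, mem_preimage, SetLike.mem_coe, LinearMap.mem_ker]
      change _ ↔ p * (x - x0) 0 + q * (x - x0) 1 = 0
      simp only [PiLp.sub_apply]
      constructor <;> intro h <;> linarith
    rw [hs, vol_preimage_sub]
    apply Measure.addHaar_submodule
    intro htop
    have h1 : (!₂[p, q] : Pt) ∈ LinearMap.ker g := by rw [htop]; trivial
    have h2 : p * p + q * q = 0 := by simpa [g] using h1
    rcases h with h | h
    · have := mul_self_pos.2 h; nlinarith [mul_self_nonneg q]
    · have := mul_self_pos.2 h; nlinarith [mul_self_nonneg p]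
  · have : {x : Pt | p * x 0 + q * x 1 = c} = ∅ := by
      ext x; simp only [mem_ofPred_eq, mem_empty_iff_false, iff_false]
      exact fun hx => hne ⟨x, hx⟩
    rw [this]; simp

lemma pt_ext {a b : Pt} (h0 : a 0 = b 0) (h1 : a 1 = b 1) : a = b := by
  ext i; fin_cases i <;> assumption

lemma vol_orr_line (a b : Pt) (h : a ≠ b) : volume {x : Pt | orr a b x = 0} = 0 := by
  have := vol_line (-(b 1 - a 1)) (b 0 - a 0) ((b 0 - a 0) * a 1 - (b 1 - a 1) * a 0) (by
    by_contra hh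
    push Not at hh
    exact h (pt_ext (by linarith [hh.2]) (by linarith [hh.1])))
  convert this using 4 with x
  simp only [orr]
  constructor <;> intro h <;> linarith

lemma tri_subset (u a b : Pt) (h : 0 < orr u a b) : tri u a b ⊆ convexHull ℝ {u, a, b} := by
  rintro x ⟨h1, h2, h3⟩
  have hx : x = (1 - orr u x b / orr u a b - orr u a x / orr u a b) • u +
      ((orr u x b / orr u a b) • a + (orr u a x / orr u a b) • b) := by
    apply pt_ext
    · simp
      field_simp
      simp only [orr]; ring
    · simp
      field_simp
      simp only [orr]; ring
  rw [convexHull_insert (by simp), convexHull_pair]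
  rw [hx]
  set α := orr u x b / orr u a b
  set β := orr u a x / orr u a b
  have ha : 0 ≤ α := by positivity
  have hb : 0 ≤ β := by positivity
  have hab : α + β ≤ 1 := by
    simp only [α, β]; rw [← add_div, div_le_one h]; linarith
  rw [← convexHull_pair, ← convexHull_insert (by simp)]
  have := convex_convexHull ℝ ({u, a, b} : Set Pt)
  have hu : u ∈ convexHull ℝ ({u, a, b} : Set Pt) := subset_convexHull _ _ (by simp)
  have ha' : a ∈ convexHull ℝ ({u, a, b} : Set Pt) := subset_convexHull _ _ (by simp)
  have hb' : b ∈ convexHull ℝ ({u, a, b} : Set Pt) := subset_convexHull _ _ (by simp)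
  have := this.sum_mem (t := Finset.univ) (w := ![1 - α - β, α, β]) (z := ![u, a, b])
    (by intro i _; fin_cases i <;> simp <;> linarith) (by simp [Fin.sum_univ_three]; ring)
    (by intro i _; fin_cases i <;> simp [hu, ha', hb'])
  simpa [Fin.sum_univ_three, add_assoc] using this

lemma orr_combo (a b x y : Pt) (s t : ℝ) (h : s + t = 1) :
    orr a b (s • x + t • y) = s * orr a b x + t * orr a b y := by
  have : s = 1 - t := by linarith
  subst this
  simp [orr]; ring

lemma orr_cyc (a b c : Pt) : orr a b c = orr b c a := by simp only [orr]; ring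

lemma orr_swap (a b c : Pt) : orr b a c = - orr a b c := by simp only [orr]; ring

lemma orr_split (u a b c : Pt) : orr a b c = orr u a b + orr u b c + orr u c a := by
  simp only [orr]; ring

lemma orr_pluck (u t a b x : Pt) :
    orr u t a * orr u b x - orr u t b * orr u a x + orr u t x * orr u a b = 0 := by
  simp only [orr]; ring

lemma orr_cont (a b : Pt) : Continuous (fun x => orr a b x) := by
  unfold orr; fun_prop

lemma convex_nonneg (k : ℝ) (a b : Pt) : Convex ℝ {x : Pt | 0 ≤ k * orr a b x} := by
  intro x hx y hy s t hs ht hst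
  simp only [mem_ofPred_eq] at *
  rw [orr_combo _ _ _ _ _ _ hst]
  nlinarith [mul_nonneg hs hx, mul_nonneg ht hy]

lemma hull_nonneg (k : ℝ) (a b : Pt) (S : Set Pt) (h : ∀ q ∈ S, 0 ≤ k * orr a b q) :
    ∀ x ∈ convexHull ℝ S, 0 ≤ k * orr a b x := fun _ hx =>
  convexHull_min (fun q hq => h q hq) (convex_nonneg k a b) hx

lemma gp_orr {S : Set Pt} (h : GenPos S) {a b c : Pt} (ha : a ∈ S) (hb : b ∈ S) (hc : c ∈ S)
    (hab : a ≠ b) (hbc : b ≠ c) (hac : a ≠ c) : orr a b c ≠ 0 := by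
  intro h0
  apply h a b c ha hb hc hab hbc hac
  rw [collinear_iff_of_mem (p₀ := a) (by simp)]
  refine ⟨b - a, ?_⟩
  have hd : (b 0 - a 0) ^ 2 + (b 1 - a 1) ^ 2 ≠ 0 := by
    intro hz
    apply hab
    apply pt_ext
    · nlinarith [sq_nonneg (b 0 - a 0), sq_nonneg (b 1 - a 1)]
    · nlinarith [sq_nonneg (b 0 - a 0), sq_nonneg (b 1 - a 1)]
  intro p hp
  simp only [mem_insert_iff, mem_singleton_iff] at hp
  rcases hp with rfl | rfl | rfl
  · exact ⟨0, by simp⟩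
  · exact ⟨1, by simp⟩
  · refine ⟨((p 0 - a 0) * (b 0 - a 0) + (p 1 - a 1) * (b 1 - a 1)) /
      ((b 0 - a 0) ^ 2 + (b 1 - a 1) ^ 2), ?_⟩
    unfold orr at h0
    apply pt_ext
    · simp
      field_simp
      linear_combination (-(b 1 - a 1)) * h0
    · simp
      field_simp
      linear_combination ((b 0 - a 0)) * h0

lemma edge_sign {S : Set Pt} (hS : S.Finite) {a b : Pt} (ha : a ∈ S) (hb : b ∈ S) (hab : a ≠ b)
    (hseg : segment ℝ a b ⊆ frontier (convexHull ℝ S)) :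
    (∀ q ∈ S, 0 ≤ orr a b q) ∨ (∀ q ∈ S, orr a b q ≤ 0) := by
  have hcl : IsClosed (convexHull ℝ S) := hS.isClosed_convexHull ℝ
  have hcv := convex_convexHull ℝ S
  by_cases hne_int : (interior (convexHull ℝ S)).Nonempty
  · set m : Pt := (1 / 2 : ℝ) • a + (1 / 2 : ℝ) • b with hm
    have hmf : m ∈ frontier (convexHull ℝ S) :=
      hseg ⟨1 / 2, 1 / 2, by norm_num, by norm_num, by norm_num, rfl⟩
    obtain ⟨f, hf⟩ := geometric_hahn_banach_open_point hcv.interior isOpen_interior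
      (x := m) (fun h => hmf.2 h)
    have hle : ∀ x ∈ convexHull ℝ S, f x ≤ f m := by
      intro x hx
      have hx' : x ∈ closure (interior (convexHull ℝ S)) := by
        rw [hcv.closure_interior_eq_closure_of_nonempty_interior hne_int]; exact subset_closure hx
      exact closure_minimal (fun y hy => (hf y hy).le)
        (isClosed_le f.continuous continuous_const) hx'
    have hfm : f m = (f a + f b) / 2 := by
      rw [hm, map_add, map_smul, map_smul]; simp; ring
    have h1 := hle a (subset_convexHull _ _ ha)
    have h2 := hle b (subset_convexHull _ _ hb)
    have hfab : f a = f b := by linarith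
    set e0 : Pt := !₂[1, 0]
    set e1 : Pt := !₂[0, 1]
    have hfx : ∀ x : Pt, f x = x 0 * f e0 + x 1 * f e1 := by
      intro x
      have : x = x 0 • e0 + x 1 • e1 := by
        apply pt_ext <;> simp [e0, e1]
      conv_lhs => rw [this]
      rw [map_add, map_smul, map_smul]; simp
    set k := (b 0 - a 0) * f e1 - (b 1 - a 1) * f e0 with hk
    have hd : 0 < (b 0 - a 0) ^ 2 + (b 1 - a 1) ^ 2 := by
      by_contra hz
      apply hab
      apply pt_ext
      · nlinarith [sq_nonneg (b 0 - a 0), sq_nonneg (b 1 - a 1)]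
      · nlinarith [sq_nonneg (b 0 - a 0), sq_nonneg (b 1 - a 1)]
    have key : ∀ x : Pt, (f x - f a) * ((b 0 - a 0) ^ 2 + (b 1 - a 1) ^ 2) = k * orr a b x := by
      intro x
      rw [hfx a, hfx b] at hfab
      rw [hfx x, hfx a, hk]
      unfold orr
      linear_combination (-((b 0 - a 0) * (x 0 - a 0) + (b 1 - a 1) * (x 1 - a 1))) * hfab
    obtain ⟨z, hz⟩ := hne_int
    have hzlt := hf z hz
    have hall : ∀ q ∈ S, k * orr a b q ≤ 0 := by
      intro q hq
      rw [← key]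
      have := hle q (subset_convexHull _ _ hq)
      exact mul_nonpos_of_nonpos_of_nonneg (by linarith) hd.le
    have hkz : k * orr a b z < 0 := by
      rw [← key]; exact mul_neg_of_neg_of_pos (by linarith) hd
    rcases lt_trichotomy k 0 with h | h | h
    · left; intro q hq; nlinarith [hall q hq]
    · rw [h] at hkz; simp at hkz
    · right; intro q hq; nlinarith [hall q hq]
  · left
    intro q hq
    by_contra hneg
    push Not at hneg
    have h1 : 0 < orr b a q := by rw [orr_swap]; linarith
    have hv := vol_tri b a q h1
    have hsub : tri b a q ⊆ frontier (convexHull ℝ S) := by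
      rw [frontier, not_nonempty_iff_eq_empty.1 hne_int, sdiff_empty]
      refine ((tri_subset b a q h1).trans (convexHull_mono ?_)).trans subset_closure
      intro x hx
      simp only [mem_insert_iff, mem_singleton_iff] at hx
      rcases hx with rfl | rfl | rfl <;> assumption
    have := measure_mono_null hsub (hcv.addHaar_frontier volume)
    rw [hv] at this
    simp at this
    linarith

lemma edge_vertex {S : Set Pt} (h : GenPos S) {a b : Pt} (ha : a ∈ S) (hb : b ∈ S) (hab : a ≠ b)
    (k : ℝ) (hk : k ≠ 0) (hs : ∀ q ∈ S, 0 ≤ k * orr a b q) : IsHullVertex S a := by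
  refine ⟨ha, fun hmem => ?_⟩
  have hsub : convexHull ℝ (S \ {a}) ⊆ {x | 0 < k * orr a b x ∨ x = b} := by
    apply convexHull_min
    · rintro q ⟨hq, hqa⟩
      simp only [mem_singleton_iff] at hqa
      by_cases hqb : q = b
      · right; exact hqb
      · left
        exact lt_of_le_of_ne (hs q hq)
          (mul_ne_zero hk (gp_orr h ha hb hq hab (Ne.symm hqb) (Ne.symm hqa))).symm
    · have hb0 : orr a b b = 0 := by simp only [orr]; ring
      intro x hx y hy s t hs ht hst
      simp only [mem_ofPred_eq] at *
      rcases hx with hx | rfl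
      · rcases hs.eq_or_lt with hs0 | hs0
        · have : t = 1 := by linarith
          subst this; rw [← hs0]; simpa using hy
        · left
          rw [orr_combo _ _ _ _ _ _ hst]
          have : 0 ≤ k * orr a b y := by
            rcases hy with hy | rfl
            · exact hy.le
            · rw [hb0]; simp
          nlinarith [mul_pos hs0 hx, mul_nonneg ht this]
      · rcases hy with hy | rfl
        · rcases ht.eq_or_lt with ht0 | ht0
          · have : s = 1 := by linarith
            subst this; rw [← ht0]; simp
          · left
            rw [orr_combo _ _ _ _ _ _ hst, hb0]
            nlinarith [mul_pos ht0 hy]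
        · right; rw [← add_smul, hst, one_smul]
  rcases hsub hmem with h1 | h1
  · have : orr a b a = 0 := by simp only [orr]; ring
    rw [this] at h1; simp at h1
  · exact hab h1

/-- The edge `a b` of the hull of `Q` is visible from `u`. -/
def Vis (Q : Set Pt) (u a b : Pt) : Prop := ∀ q ∈ Q, orr a b q * orr u a b ≤ 0

lemma vis_or {P : Set Pt} (hfin : P.Finite) (hgp : GenPos P) {u a b : Pt} (hu : u ∈ P)
    (hadj : AdjacentVertices (P \ {u}) a b) :
    Vis (P \ {u}) u a b ∨ (IsHullVertex P a ∧ IsHullVertex P b ∧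
      (∀ q ∈ P, 0 ≤ orr u a b * orr a b q) ∧ ∃ q ∈ P \ {u}, 0 < orr u a b * orr a b q) := by
  by_cases hv : Vis (P \ {u}) u a b
  · exact Or.inl hv
  right
  obtain ⟨hab, ⟨ha, -⟩, ⟨hb, -⟩, hseg⟩ := hadj
  unfold Vis at hv
  push Not at hv
  obtain ⟨q, hq, hqpos⟩ := hv
  have hD : orr u a b ≠ 0 := by rintro h; rw [h] at hqpos; simp at hqpos
  have hall : ∀ p ∈ P, 0 ≤ orr u a b * orr a b p := by
    intro p hp
    by_cases hpu : p = u
    · rw [hpu, ← orr_cyc u a b]; exact mul_self_nonneg _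
    rcases edge_sign (hfin.subset sdiff_subset) ha hb hab hseg with h | h
    · have h1 := h p ⟨hp, hpu⟩
      have h2 := h q hq
      have : 0 < orr u a b := by
        by_contra hneg; push Not at hneg
        nlinarith
      positivity
    · have h1 := h p ⟨hp, hpu⟩
      have h2 := h q hq
      have : orr u a b < 0 := by
        by_contra hneg; push Not at hneg
        nlinarith
      nlinarith
  refine ⟨edge_vertex hgp ha.1 hb.1 hab _ hD hall, 
    edge_vertex hgp hb.1 ha.1 hab.symm (-orr u a b) (neg_ne_zero.2 hD) ?_, hall, q, hq,
    by linarith⟩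
  intro p hp
  rw [orr_swap a b p]
  linarith [hall p hp]

lemma vis_step {P : Set Pt} (hgp : GenPos P) {u a b c : Pt} (hu : u ∈ P)
    (ha : a ∈ P \ {u}) (hb : b ∈ P \ {u}) (hc : c ∈ P \ {u}) (hab : a ≠ b) (hbc : b ≠ c)
    (hac : a ≠ c) (h1 : Vis (P \ {u}) u a b) (h2 : Vis (P \ {u}) u b c) (hpos : 0 < orr u a b) :
    0 < orr u b c := by
  by_contra hneg
  push Not at hneg
  have hne : orr u b c ≠ 0 := gp_orr hgp hu hb.1 hc.1 (Ne.symm hb.2) hbc (Ne.symm hc.2)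
  have hne2 := gp_orr hgp ha.1 hb.1 hc.1 hab hbc hac
  have hlt := lt_of_le_of_ne hneg hne
  have e1 := h1 c hc
  have e2 := h2 a ha
  rw [← orr_cyc a b c] at e2
  apply hne2
  nlinarith

/-- Half plane. -/
def Hp (u a : Pt) : Set Pt := {x | 0 ≤ orr u a x}

/-- Wedge. -/
def Wd (u a b : Pt) : Set Pt := {x | 0 ≤ orr u a x ∧ orr u b x ≤ 0}

lemma meas_Hp (u a : Pt) : MeasurableSet (Hp u a) :=
  (isClosed_le continuous_const (orr_cont u a)).measurableSet

lemma meas_Wd (u a b : Pt) : MeasurableSet (Wd u a b) := by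
  have h1 : IsClosed {x : Pt | 0 ≤ orr u a x} := isClosed_le continuous_const (orr_cont u a)
  have h2 : IsClosed {x : Pt | orr u b x ≤ 0} := isClosed_le (orr_cont u b) continuous_const
  exact (h1.inter h2).measurableSet

lemma meas_tri (u a b : Pt) : MeasurableSet (tri u a b) := by
  have hc : Continuous fun x => orr u x b := by unfold orr; fun_prop
  have h1 : IsClosed {x : Pt | 0 ≤ orr u a x} := isClosed_le continuous_const (orr_cont u a)
  have h2 : IsClosed {x : Pt | 0 ≤ orr u x b} := isClosed_le continuous_const hc
  have h3 : IsClosed {x : Pt | orr u a x + orr u x b ≤ orr u a b} :=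
    isClosed_le ((orr_cont u a).add hc) continuous_const
  exact (h1.inter (h2.inter h3)).measurableSet

lemma wedge_eq {K : Set Pt} (hK : Convex ℝ K) {u a b : Pt} (ha : a ∈ K) (hb : b ∈ K)
    (hD : 0 < orr u a b) :
    convexJoin ℝ {u} K ∩ Wd u a b = (K ∩ Wd u a b) ∪ tri u a b := by
  have hanti : ∀ x, orr u x b = - orr u b x := by intro x; simp only [orr]; ring
  have huu : ∀ c, orr u c u = 0 := by intro c; simp only [orr]; ring
  have hKsub : ∀ y ∈ K, y ∈ convexJoin ℝ {u} K := fun y hy =>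
    mem_convexJoin.2 ⟨u, rfl, y, hy, right_mem_segment ℝ u y⟩
  have hu : u ∈ convexJoin ℝ {u} K := mem_convexJoin.2 ⟨u, rfl, a, ha, left_mem_segment ℝ u a⟩
  apply Subset.antisymm
  · rintro x ⟨hx, hxa, hxb⟩
    obtain ⟨u', hu', y, hy, hxy⟩ := mem_convexJoin.1 hx
    rw [mem_singleton_iff] at hu'
    subst hu'
    obtain ⟨p, l, hp, hl, hpl, rfl⟩ := hxy
    set x := p • u' + l • y with hxdef
    by_cases hab : 0 ≤ orr a b x
    · right
      refine ⟨hxa, by rw [hanti]; linarith, ?_⟩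
      have := orr_split u' a b x
      have h2 : orr u' x a = - orr u' a x := by simp only [orr]; ring
      rw [hanti]; linarith
    · left
      refine ⟨?_, hxa, hxb⟩
      push Not at hab
      have hsp := orr_split u' a b x
      have h2 : orr u' x a = - orr u' a x := by simp only [orr]; ring
      set A := orr u' x b with hA
      set B := orr u' a x with hB
      set D := orr u' a b with hDd
      have hA0 : 0 ≤ A := by rw [hA, hanti]; linarith
      have hB0 : 0 ≤ B := hxa
      have hsD : D < A + B := by rw [hA, hanti]; linarith
      have hl1 : l ≤ 1 := by linarith
      have hN : 0 < A + B - l * D := by nlinarith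
      have hid0 : A * (a 0 - u' 0) + B * (b 0 - u' 0) = D * (x 0 - u' 0) := by
        rw [hA, hB, hDd]; simp only [orr]; ring
      have hid1 : A * (a 1 - u' 1) + B * (b 1 - u' 1) = D * (x 1 - u' 1) := by
        rw [hA, hB, hDd]; simp only [orr]; ring
      have hx0 : x 0 = p * u' 0 + l * y 0 := by simp [hxdef]
      have hx1 : x 1 = p * u' 1 + l * y 1 := by simp [hxdef]
      have hpe : p = 1 - l := by linarith
      have hxe : x = (p * A / (A + B - l * D)) • a + (p * B / (A + B - l * D)) • b +
          (l * (A + B - D) / (A + B - l * D)) • y := by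
        clear_value x A B D
        subst hpe
        apply pt_ext
        · simp
          field_simp
          linear_combination (-(1 - l)) * hid0 + (A + B - D) * hx0
        · simp
          field_simp
          linear_combination (-(1 - l)) * hid1 + (A + B - D) * hx1
      rw [hxe]
      have := hK.sum_mem (t := Finset.univ)
        (w := ![p * A / (A + B - l * D), p * B / (A + B - l * D),
          l * (A + B - D) / (A + B - l * D)]) (z := ![a, b, y])
        (by
          have : 0 ≤ A + B - D := by linarith
          intro i _; fin_cases i <;> simp <;> positivity)
        (by 
          simp [Fin.sum_univ_three]
          field_simp
          rw [hpe]; ring)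
        (by intro i _; fin_cases i <;> simp [ha, hb, hy])
      simpa [Fin.sum_univ_three, add_assoc] using this
  · rintro x (⟨hx, hw⟩ | hx)
    · exact ⟨hKsub x hx, hw⟩
    · refine ⟨?_, hx.1, by have := hx.2.1; rw [hanti] at this; linarith⟩
      have h1 := tri_subset u a b hD hx
      refine convexHull_min ?_ ((convex_singleton u).convexJoin hK) h1
      intro z hz
      simp only [mem_insert_iff, mem_singleton_iff] at hz
      rcases hz with rfl | rfl | rfl
      · exact hu
      · exact hKsub _ ha
      · exact hKsub _ hb

lemma orr_ne_of_pos {u a b : Pt} (h : 0 < orr u a b) : u ≠ a ∧ u ≠ b ∧ a ≠ b := by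
  refine ⟨?_, ?_, ?_⟩ <;> rintro rfl <;> simp [orr] at h <;> nlinarith

lemma wedge_vol {K : Set Pt} (hK : Convex ℝ K) (hKc : IsCompact K) {u a b : Pt} (ha : a ∈ K)
    (hb : b ∈ K) (hD : 0 < orr u a b) (hside : ∀ x ∈ K, orr a b x ≤ 0) :
    volume.real (convexJoin ℝ {u} K ∩ Wd u a b) =
      volume.real (K ∩ Wd u a b) + orr u a b / 2 := by
  rw [wedge_eq hK ha hb hD]
  have hfin : volume (tri u a b) ≠ ⊤ := by rw [vol_tri _ _ _ hD]; exact ENNReal.ofReal_ne_top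
  rw [measureReal_union₀ (meas_tri u a b).nullMeasurableSet ?_
    (measure_ne_top_of_subset inter_subset_left hKc.measure_lt_top.ne) hfin]
  · congr 1
    rw [measureReal_def, vol_tri _ _ _ hD, ENNReal.toReal_ofReal (by linarith)]
  · refine measure_mono_null ?_ (vol_orr_line a b (orr_ne_of_pos hD).2.2)
    rintro x ⟨⟨hx, -⟩, h1, h2, h3⟩
    have e1 := hside x hx
    have e2 := orr_split u a b x
    have e3 : orr u x a = - orr u a x := by simp only [orr]; ring
    have e4 : orr u x b = - orr u b x := by simp only [orr]; ring
    simp only [mem_ofPred_eq]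
    linarith

lemma split_vol {X : Set Pt} (hX : IsCompact X) {u t a b : Pt} (hcone : ∀ x ∈ X, 0 ≤ orr u t x)
    (hta : 0 ≤ orr u t a) (htb : 0 < orr u t b) (hD : 0 < orr u a b) :
    volume.real (X ∩ Hp u a) = volume.real (X ∩ Hp u b) + volume.real (X ∩ Wd u a b) := by
  have hset : X ∩ Hp u a = (X ∩ Hp u b) ∪ (X ∩ Wd u a b) := by
    ext x
    constructor
    · rintro ⟨hx, ha⟩
      rcases le_total 0 (orr u b x) with h | h
      · exact Or.inl ⟨hx, h⟩
      · exact Or.inr ⟨hx, ha, h⟩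
    · rintro (⟨hx, hb⟩ | ⟨hx, ha, -⟩)
      · refine ⟨hx, ?_⟩
        have e := orr_pluck u t a b x
        have h1 : 0 ≤ orr u t a * orr u b x := mul_nonneg hta hb
        have h2 : 0 ≤ orr u t x * orr u a b := mul_nonneg (hcone x hx) hD.le
        have h3 : 0 ≤ orr u t b * orr u a x := by linarith
        exact nonneg_of_mul_nonneg_right h3 htb
      · exact ⟨hx, ha⟩
  have hf : ∀ Y, volume (X ∩ Y) ≠ ⊤ := fun Y =>
    measure_ne_top_of_subset inter_subset_left hX.measure_lt_top.ne
  rw [hset, measureReal_union₀ (hX.measurableSet.inter (meas_Wd u a b)).nullMeasurableSet ?_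
    (hf _) (hf _)]
  refine measure_mono_null ?_ (vol_orr_line u b (orr_ne_of_pos hD).2.1)
  rintro x ⟨⟨_, h1⟩, _, _, h2⟩
  exact le_antisymm h2 h1

/-- Difference of the two areas in a half plane. -/
def Fd (H K : Set Pt) (u a : Pt) : ℝ := volume.real (H ∩ Hp u a) - volume.real (K ∩ Hp u a)

/-- Sum of the oriented areas. -/
def chainSum (u : Pt) : List Pt → ℝ
  | a :: b :: l => orr u a b + chainSum u (b :: l)
  | _ => 0

lemma Fd_chain {Q : Set Pt} (hQ : Q.Finite) {u t v : Pt}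
    (hcone : ∀ q ∈ Q, 0 ≤ orr u t q) 
    (hcone' : ∀ q ∈ Q, q ≠ t → 0 < orr u t q) (l : List Pt) : ∀ a : Pt,
    List.IsChain (fun a b => a ∈ Q ∧ b ∈ Q ∧ 0 < orr u a b ∧ Vis Q u a b) (a :: (l ++ [v])) →
    Fd (convexHull ℝ (insert u Q)) (convexHull ℝ Q) u a -
      Fd (convexHull ℝ (insert u Q)) (convexHull ℝ Q) u v = chainSum u (a :: (l ++ [v])) / 2 := by
  have hKc : IsCompact (convexHull ℝ Q) := hQ.isCompact_convexHull ℝ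
  have hHc : IsCompact (convexHull ℝ (insert u Q)) := (hQ.insert u).isCompact_convexHull ℝ
  have step : ∀ a b : Pt, (a ∈ Q ∧ b ∈ Q ∧ 0 < orr u a b ∧ Vis Q u a b) →
      Fd (convexHull ℝ (insert u Q)) (convexHull ℝ Q) u a =
      Fd (convexHull ℝ (insert u Q)) (convexHull ℝ Q) u b + orr u a b / 2 := by
    rintro a b ⟨ha, hb, hD, hv⟩
    have hta := hcone a ha
    have hbt : b ≠ t := by
      rintro rfl
      have : orr u a b = - orr u b a := by simp only [orr]; ring
      linarith
    have htb := hcone' b hb hbt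
    have hut : orr u t u = 0 := by simp only [orr]; ring
    have hcK : ∀ x ∈ convexHull ℝ Q, 0 ≤ orr u t x := by
      have := hull_nonneg 1 u t Q (by simpa using hcone)
      simpa using this
    have hcH : ∀ x ∈ convexHull ℝ (insert u Q), 0 ≤ orr u t x := by
      have := hull_nonneg 1 u t (insert u Q) (by
        intro q hq
        rcases hq with rfl | hq
        · rw [hut]; simp
        · simpa using hcone q hq)
      simpa using this
    have hside : ∀ x ∈ convexHull ℝ Q, orr a b x ≤ 0 := by
      intro x hx
      have := hull_nonneg (-1) a b Q (by
        intro q hq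
        have := hv q hq
        have : orr a b q ≤ 0 := nonpos_of_mul_nonpos_left this hD
        linarith) x hx
      linarith
    have e1 := split_vol hHc hcH hta htb hD
    have e2 := split_vol hKc hcK hta htb hD
    have e3 := wedge_vol (convex_convexHull ℝ Q) hKc (subset_convexHull _ _ ha)
      (subset_convexHull _ _ hb) hD hside
    rw [← convexHull_insert ⟨a, ha⟩] at e3
    unfold Fd
    linarith
  induction l with
  | nil =>
    intro a h
    simp only [List.nil_append] at h ⊢
    rw [List.isChain_cons_cons] at h
    rw [step a v h.1]
    simp [chainSum]
  | cons b l ih =>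
    intro a h
    simp only [List.cons_append] at h ⊢
    rw [List.isChain_cons_cons] at h
    have := ih b h.2
    rw [step a b h.1]
    simp only [chainSum]
    linarith

lemma chain_pos {P : Set Pt} (hgp : GenPos P) {u : Pt} (hu : u ∈ P) (l : List Pt) : ∀ a b : Pt,
    List.IsChain (fun a b => AdjacentVertices (P \ {u}) a b ∧ Vis (P \ {u}) u a b) (a :: b :: l) →
    (a :: b :: l).Nodup → 0 < orr u a b →
    List.IsChain (fun a b => a ∈ P \ {u} ∧ b ∈ P \ {u} ∧ 0 < orr u a b ∧ Vis (P \ {u}) u a b)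
      (a :: b :: l) := by
  induction l with
  | nil =>
    intro a b h _ hpos
    simp only [List.isChain_cons_cons] at h ⊢
    exact ⟨⟨h.1.1.2.1.1, h.1.1.2.2.1.1, hpos, h.1.2⟩, List.IsChain.singleton _⟩
  | cons c l ih =>
    intro a b h hnd hpos
    rw [List.isChain_cons_cons] at h ⊢
    have h2 := h.2
    rw [List.isChain_cons_cons] at h2
    refine ⟨⟨h.1.1.2.1.1, h.1.1.2.2.1.1, hpos, h.1.2⟩, ih b c h.2 hnd.of_cons ?_⟩
    refine vis_step hgp hu h.1.1.2.1.1 h.1.1.2.2.1.1 h2.1.1.2.2.1.1 h.1.1.1 h2.1.1.1 ?_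
      h.1.2 h2.1.2 hpos
    rintro rfl
    simp at hnd

lemma chain_vis {P : Set Pt} (hfin : P.Finite) (hgp : GenPos P) {u v : Pt} (hu : u ∈ P)
    (l : List Pt) : ∀ x : Pt, (∀ y ∈ x :: l, ¬ IsHullVertex P y) →
    List.IsChain (AdjacentVertices (P \ {u})) (x :: (l ++ [v])) →
    List.IsChain (fun a b => AdjacentVertices (P \ {u}) a b ∧ Vis (P \ {u}) u a b)
      (x :: (l ++ [v])) := by
  have key : ∀ a b, ¬ IsHullVertex P a → AdjacentVertices (P \ {u}) a b →
      Vis (P \ {u}) u a b := by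
    intro a b ha hab
    rcases vis_or hfin hgp hu hab with h | h
    · exact h
    · exact absurd h.1 ha
  induction l with
  | nil =>
    intro x hx h
    simp only [List.nil_append, List.isChain_cons_cons] at h ⊢
    exact ⟨⟨h.1, key _ _ (hx x (by simp)) h.1⟩, List.IsChain.singleton _⟩
  | cons b l ih =>
    intro x hx h
    simp only [List.cons_append] at h ⊢
    rw [List.isChain_cons_cons] at h ⊢
    exact ⟨⟨h.1, key _ _ (hx x (by simp)) h.1⟩, ih b (fun y hy => hx y (by simp_all)) h.2⟩

/-- Open shoelace sum. -/
def ps : List Pt → ℝ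
  | a :: b :: l => (a 0 * b 1 - b 0 * a 1) + ps (b :: l)
  | _ => 0

lemma zip_ps (l : List Pt) (y : Pt) : ∀ x : Pt,
    (((x :: l).zip (l ++ [y])).map (fun q => q.1 0 * q.2 1 - q.2 0 * q.1 1)).sum
      = ps (x :: (l ++ [y])) := by
  induction l with
  | nil => intro x; simp [ps]
  | cons b l ih =>
    intro x
    have := ih b
    simp only [List.cons_append, List.zip_cons_cons, List.map_cons, List.sum_cons, ps] at this ⊢
    rw [this]

lemma ps_append (l : List Pt) (a b : Pt) :
    ps (l ++ [a, b]) = ps (l ++ [a]) + (a 0 * b 1 - b 0 * a 1) := by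
  induction l with
  | nil => simp [ps]
  | cons c l ih =>
    cases l with
    | nil => simp [ps]
    | cons d l =>
      simp only [List.cons_append, ps] at ih ⊢
      rw [ih]; ring

lemma ps_reverse (l : List Pt) : ps l.reverse = - ps l := by
  induction l with
  | nil => simp [ps]
  | cons a l ih =>
    cases l with
    | nil => simp [ps]
    | cons b l =>
      have := ps_append l.reverse b a
      simp only [List.reverse_cons, List.append_assoc, List.cons_append, List.nil_append] at ih this ⊢
      rw [this, ih]
      simp only [ps]; ring

lemma chainSum_eq (u v : Pt) (l : List Pt) : ∀ a : Pt,
    chainSum u (a :: (l ++ [v])) = ps (a :: (l ++ [v])) + (v 0 * u 1 - u 0 * v 1)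
      + (u 0 * a 1 - a 0 * u 1) := by
  induction l with
  | nil => intro a; simp [chainSum, ps, orr]; ring
  | cons b l ih =>
    intro a
    have := ih b
    simp only [List.cons_append, chainSum, ps] at this ⊢
    rw [this]; simp only [orr]; ring

lemma chainSum_nonneg {u : Pt} (R : Pt → Pt → Prop) (hR : ∀ a b, R a b → 0 < orr u a b)
    (l : List Pt) : List.IsChain R l → 0 ≤ chainSum u l := by
  intro h
  induction h with
  | nil => simp [chainSum]
  | singleton a => simp [chainSum]
  | cons_cons h1 _ ih =>
    simp only [chainSum]
    linarith [hR _ _ h1]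

lemma shoelace_eq (u t v : Pt) (l : List Pt) :
    shoelace ([t, u, v] ++ l.reverse) = |chainSum u (t :: (l ++ [v]))| / 2 := by
  unfold shoelace
  have h1 : ([t, u, v] ++ l.reverse).rotate 1 = ([u, v] ++ l.reverse) ++ [t] := by
    simp
  rw [h1]
  have h2 := zip_ps ([u, v] ++ l.reverse) t t
  have h3 : [t, u, v] ++ l.reverse = t :: ([u, v] ++ l.reverse) := rfl
  rw [h3, h2]
  have h4 := ps_reverse (t :: (l ++ [v]))
  have h5 : (t :: (l ++ [v])).reverse = v :: (l.reverse ++ [t]) := by simp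
  rw [h5] at h4
  rw [chainSum_eq]
  simp only [List.cons_append, List.nil_append, ps]
  rw [h4, ← abs_neg]
  congr 2
  ring

theorem sensitivity_eq_polygon_area (P : Finset Pt)
    (hgp : GenPos (↑P : Set Pt)) (t u v : Pt)
    (hc : ConsecutiveCW (↑P : Set Pt) t u v)
    (l : List Pt) (hnd : l.Nodup)
    (hmem : ∀ p : Pt, p ∈ l ↔ ActiveFor (↑P : Set Pt) u p)
    (hchain : List.Chain' (AdjacentVertices ((↑P : Set Pt) \ {u})) (t :: l ++ [v])) :
    (hullArea (↑P : Set Pt)).toReal - (hullArea ((↑P : Set Pt) \ {u})).toReal =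
      shoelace ([t, u, v] ++ l.reverse) := by
  have hfin : (↑P : Set Pt).Finite := P.finite_toSet
  generalize (↑P : Set Pt) = S at *
  change List.IsChain _ _ at hchain
  obtain ⟨⟨htu, htv, huv', hseg1⟩, ⟨huv, -, hvv, hseg2⟩, htnev, hcr⟩ := hc
  have htS := htv.1
  have huS := huv'.1
  have hvS := hvv.1
  have hD : 0 < orr u t v := by
    refine lt_of_le_of_ne ?_ (gp_orr hgp huS htS hvS htu.symm htnev huv).symm
    have : orr u t v = - cross2 (u - t) (v - u) := by
      simp [orr, cross2]; ring
    linarith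
  have hanti : ∀ a b, orr u a b = - orr u b a := by intro a b; simp only [orr]; ring
  have hcone : ∀ q ∈ S, 0 ≤ orr u t q := by
    intro q hq
    have e : ∀ x, orr t u x = - orr u t x := fun x => orr_swap u t x
    rcases edge_sign hfin htS huS htu hseg1 with h | h
    · have := h v hvS; rw [e] at this; linarith
    · have := h q hq; rw [e] at this; linarith
  have hcone2 : ∀ q ∈ S, orr u v q ≤ 0 := by
    intro q hq
    rcases edge_sign hfin huS hvS huv hseg2 with h | h
    · have := h t htS; rw [hanti] at this; linarith
    · exact h q hq
  have hins : insert u (S \ {u}) = S := insert_sdiff_self_of_mem huS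
  have htl : t ∉ l := fun h => ((hmem t).1 h).2 htv
  have hvl : v ∉ l := fun h => ((hmem v).1 h).2 hvv
  have hnd' : (t :: (l ++ [v])).Nodup := by
    rw [List.nodup_cons]
    refine ⟨by simp [htl, htnev], ?_⟩
    rw [List.nodup_append]
    refine ⟨hnd, by simp, ?_⟩
    rintro a ha b hb rfl
    simp only [List.mem_singleton] at hb
    exact hvl (hb ▸ ha)
  have hvis : List.IsChain (fun a b => AdjacentVertices (S \ {u}) a b ∧ Vis (S \ {u}) u a b)
      (t :: (l ++ [v])) := by
    cases l with
    | cons x l =>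
      simp only [List.cons_append] at hchain ⊢
      rw [List.isChain_cons_cons] at hchain ⊢
      have hact : ∀ y ∈ x :: l, ¬ IsHullVertex S y := fun y hy => ((hmem y).1 hy).2
      refine ⟨⟨hchain.1, ?_⟩, chain_vis hfin hgp huS l x hact hchain.2⟩
      rcases vis_or hfin hgp huS hchain.1 with h | h
      · exact h
      · exact absurd h.2.1 (hact x (by simp))
    | nil =>
      simp only [List.nil_append, List.cons_append] at hchain ⊢
      rw [List.isChain_cons_cons] at hchain ⊢
      refine ⟨⟨hchain.1, ?_⟩, List.IsChain.singleton _⟩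
      rcases vis_or hfin hgp huS hchain.1 with h | h
      · exact h
      exfalso
      obtain ⟨-, -, hall, q, hq, hqpos⟩ := h
      have hQfin : (S \ {u}).Finite := hfin.subset sdiff_subset
      have hKM := closure_convexHull_extremePoints (hQfin.isCompact_convexHull ℝ)
        (convex_convexHull ℝ (S \ {u}))
      have hex : ∃ p ∈ (convexHull ℝ (S \ {u})).extremePoints ℝ, 0 < orr t v p := by
        by_contra hno
        push Not at hno
        have h1 := hull_nonneg (-1) t v _ (fun p hp => by linarith [hno p hp])
        have h2 : q ∈ closure (convexHull ℝ ((convexHull ℝ (S \ {u})).extremePoints ℝ)) := by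
          rw [hKM]; exact subset_convexHull _ _ hq
        have h3 : 0 ≤ -1 * orr t v q :=
          closure_minimal (s := convexHull ℝ ((convexHull ℝ (S \ {u})).extremePoints ℝ))
            (t := {x : Pt | 0 ≤ -1 * orr t v x}) h1
            (isClosed_le continuous_const (continuous_const.mul (orr_cont t v))) h2
        have := (pos_iff_pos_of_mul_pos hqpos).1 hD
        linarith
      obtain ⟨p, hp, hppos⟩ := hex
      have hpQ : p ∈ S \ {u} := extremePoints_convexHull_subset hp
      have hpn := ((convex_convexHull ℝ (S \ {u})).mem_extremePoints_iff_mem_sdiff_convexHull_sdiff.1 hp).2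
      have hne := orr_ne_of_pos hppos
      have hact : ActiveFor S u p := by
        refine ⟨⟨hpQ, fun hh => hpn (convexHull_mono ?_ hh)⟩, fun hh => hh.2 ?_⟩
        · exact sdiff_subset_sdiff_left (subset_convexHull _ _)
        · have htri : p ∈ tri u t v := by
            refine ⟨hcone p hpQ.1, by rw [hanti]; linarith [hcone2 p hpQ.1], ?_⟩
            have e1 := orr_split u t v p
            have e2 := hanti p t
            have e3 := hanti p v
            linarith
          refine convexHull_mono ?_ (tri_subset u t v hD htri)
          intro z hz
          simp only [mem_insert_iff, mem_singleton_iff] at hz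
          rcases hz with rfl | rfl | rfl
          · exact ⟨huS, fun h => hpQ.2 h.symm⟩
          · exact ⟨htS, hne.2.1⟩
          · refine ⟨hvS, ?_⟩
            rintro rfl
            simp [orr] at hppos
            nlinarith
      have := (hmem p).2 hact
      simp at this
  have hcone' : ∀ q ∈ S \ {u}, q ≠ t → 0 < orr u t q := fun q hq hqt =>
    lt_of_le_of_ne (hcone q hq.1)
      (gp_orr hgp huS htS hq.1 htu.symm (Ne.symm hqt) (Ne.symm hq.2)).symm
  have hpos : List.IsChain (fun a b => a ∈ S \ {u} ∧ b ∈ S \ {u} ∧ 0 < orr u a b ∧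
      Vis (S \ {u}) u a b) (t :: (l ++ [v])) := by
    cases l with
    | nil => exact chain_pos hgp huS [] t v hvis hnd' hD
    | cons x l =>
      refine chain_pos hgp huS (l ++ [v]) t x hvis hnd' ?_
      have hxl := ((hmem x).1 (by simp)).1.1
      refine hcone' x hxl ?_
      rintro rfl
      simp at htl
  have hF := Fd_chain (hfin.subset sdiff_subset) (u := u) (t := t) (v := v)
    (Q := S \ {u}) (fun q hq => hcone q hq.1) hcone' l t hpos
  rw [hins] at hF
  have hnn := chainSum_nonneg (u := u) _ (fun a b h => h.2.2.1) _ hpos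
  rw [shoelace_eq, abs_of_nonneg hnn, ← hF]
  have hcH : ∀ x ∈ convexHull ℝ S, 0 ≤ orr u t x := by
    simpa using hull_nonneg 1 u t S (by simpa using hcone)
  have hcH2 : ∀ x ∈ convexHull ℝ S, orr u v x ≤ 0 := by
    intro x hx
    have := hull_nonneg (-1) u v S (fun q hq => by linarith [hcone2 q hq]) x hx
    linarith
  have hKH : convexHull ℝ (S \ {u}) ⊆ convexHull ℝ S := convexHull_mono sdiff_subset
  have f1 : ∀ X ⊆ convexHull ℝ S, X ∩ Hp u t = X := fun X hX =>
    inter_eq_left.2 fun x hx => hcH x (hX hx)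
  have f2 : ∀ X ⊆ convexHull ℝ S, volume.real (X ∩ Hp u v) = 0 := by
    intro X hX
    rw [measureReal_def, measure_mono_null _ (vol_orr_line u v huv)]
    · simp
    · rintro x ⟨hx, h⟩
      exact le_antisymm (hcH2 x (hX hx)) h
  unfold Fd
  rw [f1 _ subset_rfl, f1 _ hKH, f2 _ subset_rfl, f2 _ hKH]
  simp [hullArea, measureReal_def]
end
end
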